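/- Fix T > 0 and let f : ℕ → (0,∞) be bounded with a positive lower bound. Define F(t,k) := log P_{T−t} f(k) for t ∈ [0,T] and k ∈ ℕ, where P_s is the Poisson semigroup. Then for every k ∈ ℕ and every t ∈ (0,T), ∂_t F(t,k) = −e^{F(t,k+1) − F(t,k)} + 1. -/

import Mathlib

/-- The Poisson measure on ℕ with intensity `t`: `π_t(n) = e^{-t} t^n / n!`. -/
noncomputable def poissonPMF (t : ℝ) (n : ℕ) : ℝ :=
  Real.exp (-t) * t ^ n / (Nat.factorial n)

/-- The Poisson semigroup `P_t f(k) = Σ_{n∈ℕ} f(k+n) π_t(n)`. -/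
noncomputable def poissonSemigroup (t : ℝ) (f : ℕ → ℝ) (k : ℕ) : ℝ :=
  ∑' n : ℕ, f (k + n) * poissonPMF t n

theorem summable_mul_pow_div_factorial {a : ℕ → ℝ} {C : ℝ} (ha : ∀ n, |a n| ≤ C) (x : ℝ) :
    Summable fun n : ℕ => a n * (x ^ n / n.factorial) := by
  refine Summable.of_norm_bounded ((Real.summable_pow_div_factorial |x|).mul_left C) fun n => ?_
  rw [norm_mul, norm_div, norm_pow, Real.norm_eq_abs, Real.norm_eq_abs, Real.norm_natCast]
  gcongr
  exact ha n

theorem succ_mul_pow_div_factorial (x : ℝ) (n : ℕ) :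
    ((n + 1 : ℕ) : ℝ) * x ^ n / (n + 1).factorial = x ^ n / n.factorial := by
  rw [Nat.factorial_succ]
  push_cast
  have := Nat.factorial_ne_zero n
  field_simp

/-- Differentiating an exponential generating function with bounded coefficients shifts the
coefficients. -/
theorem hasDerivAt_tsum_mul_pow_div_factorial {a : ℕ → ℝ} {C : ℝ} (ha : ∀ n, |a n| ≤ C) (x : ℝ) :
    HasDerivAt (fun y : ℝ => ∑' n : ℕ, a n * (y ^ n / n.factorial))
      (∑' n : ℕ, a (n + 1) * (x ^ n / n.factorial)) x := by
  have hC : 0 ≤ C := (abs_nonneg _).trans (ha 0)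
  have hbound : ∀ n : ℕ, ∀ y ∈ Metric.ball (0 : ℝ) (|x| + 1),
      ‖a n * (n * y ^ (n - 1) / n.factorial)‖ ≤
        C * (n * (|x| + 1) ^ (n - 1) / n.factorial) := by
    intro n y hy
    rw [mem_ball_zero_iff, Real.norm_eq_abs] at hy
    rw [Real.norm_eq_abs, abs_mul, abs_div, abs_mul, abs_pow, Nat.abs_cast, Nat.abs_cast]
    gcongr
    exact ha n
  have hsum : Summable fun n : ℕ => C * (n * (|x| + 1) ^ (n - 1) / n.factorial) := by
    rw [← summable_nat_add_iff 1]
    simp only [Nat.add_sub_cancel, succ_mul_pow_div_factorial]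
    exact (Real.summable_pow_div_factorial _).mul_left C
  have hx : x ∈ Metric.ball (0 : ℝ) (|x| + 1) := by simp
  have h := hasDerivAt_tsum_of_isPreconnected hsum Metric.isOpen_ball
    (convex_ball (0 : ℝ) (|x| + 1)).isPreconnected
    (fun n y _ => (((hasDerivAt_pow n y).div_const (n.factorial : ℝ)).const_mul (a n)))
    hbound hx (summable_mul_pow_div_factorial ha x) hx
  refine h.congr_deriv ?_
  rw [(Summable.of_norm_bounded hsum fun n => hbound n x hx).tsum_eq_zero_add]
  simp only [Nat.add_sub_cancel, succ_mul_pow_div_factorial]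
  simp

theorem poissonSemigroup_eq (t : ℝ) (f : ℕ → ℝ) (k : ℕ) :
    poissonSemigroup t f k = Real.exp (-t) * ∑' n : ℕ, f (k + n) * (t ^ n / n.factorial) := by
  rw [poissonSemigroup, ← tsum_mul_left]
  congr with n
  rw [poissonPMF]
  ring

theorem hasDerivAt_poissonSemigroup {f : ℕ → ℝ} {C : ℝ} (hf : ∀ n, |f n| ≤ C) (k : ℕ) (t : ℝ) :
    HasDerivAt (fun s => poissonSemigroup s f k)
      (poissonSemigroup t f (k + 1) - poissonSemigroup t f k) t := by
  simp only [poissonSemigroup_eq]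
  have h := (hasDerivAt_neg t).exp.mul
    (hasDerivAt_tsum_mul_pow_div_factorial (a := fun n => f (k + n)) (fun n => hf (k + n)) t)
  refine h.congr_deriv ?_
  simp only [add_assoc, add_comm 1]
  ring

theorem poissonSemigroup_pos {f : ℕ → ℝ} {C : ℝ} (hf : ∀ n, |f n| ≤ C) (hpos : ∀ n, 0 < f n)
    {t : ℝ} (ht : 0 < t) (k : ℕ) : 0 < poissonSemigroup t f k := by
  rw [poissonSemigroup_eq]
  refine mul_pos (Real.exp_pos _) ?_
  refine (summable_mul_pow_div_factorial (a := fun n => f (k + n))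
    (fun n => hf (k + n)) t).tsum_pos (fun n => ?_) 0 ?_
  · have := hpos (k + n)
    positivity
  · have := hpos (k + 0)
    positivity

/-- For `f` bounded above and below by positive constants, `F(t,k) := log P_{T−t} f(k)`
satisfies `∂_t F(t,k) = −e^{F(t,k+1) − F(t,k)} + 1` for `t ∈ (0,T)`. -/
theorem F_heat_equation (T : ℝ) (hT : 0 < T) (f : ℕ → ℝ) (m M : ℝ) (hm : 0 < m)
    (hbd : ∀ k, m ≤ f k ∧ f k ≤ M)
    (F : ℝ → ℕ → ℝ)
    (hF : ∀ t k, F t k = Real.log (poissonSemigroup (T - t) f k)) :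
    ∀ k : ℕ, ∀ t ∈ Set.Ioo (0 : ℝ) T,
      HasDerivAt (fun s : ℝ => F s k) (-Real.exp (F t (k + 1) - F t k) + 1) t := by
  intro k t ht
  have hpos : ∀ n, 0 < f n := fun n => hm.trans_le (hbd n).1
  have hf : ∀ n, |f n| ≤ M := fun n => (abs_of_pos (hpos n)).trans_le (hbd n).2
  have hP := poissonSemigroup_pos hf hpos (sub_pos.2 ht.2)
  simp only [hF]
  rw [Real.exp_sub, Real.exp_log (hP _), Real.exp_log (hP _)]
  have h := ((hasDerivAt_poissonSemigroup hf k (T - t)).comp_const_sub T t).log (hP k).ne'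
  refine h.congr_deriv ?_
  have := (hP k).ne'
  field_simp
  ring
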